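/- For all integers a, b, c, let m = min{a, b, c} and let d = δ(a−m, b−m, c−m) − m, where δ(α,β,γ) = αβ + βγ + γα. Then the limit of x^{−d} · J_Δ(a,b,c)(x) as the complex number x tends to 0 (through 0 < |x| < 1) exists and is nonzero; in other words, the order of vanishing of J_Δ(a,b,c) at x = 0, as a Laurent series in x = q^{1/2}, equals δ(a−m, b−m, c−m) − m. -/

import Mathlib

open scoped BigOperators

/-- The q-Pochhammer symbol `(q;q)_n` with `q = x^2`. -/
noncomputable def qPoch (x : ℂ) (n : ℕ) : ℂ :=
  ∏ i ∈ Finset.range n, (1 - (x ^ 2) ^ (i + 1))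

/-- Summand of the tetrahedron index: `(-1)^n x^(n(n+1)-(2n+e)m) / ((q;q)_n (q;q)_{n+e})`. -/
noncomputable def tetraTerm (m e : ℤ) (x : ℂ) (n : ℤ) : ℂ :=
  (-1 : ℂ) ^ n * x ^ (n * (n + 1) - (2 * n + e) * m) /
    (qPoch x n.toNat * qPoch x (n + e).toNat)

/-- The tetrahedron index `I_Δ(m,e)(x)`, summed over `n = max(-e,0), max(-e,0)+1, …`. -/
noncomputable def tetraIndex (m e : ℤ) (x : ℂ) : ℂ :=
  ∑' j : ℕ, tetraTerm m e x (max (-e) 0 + j)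

/-- The symmetrized tetrahedron index `J_Δ(a,b,c)(x) = (-x)^{-b} I_Δ(b-c, a-b)(x)`. -/
noncomputable def Jsym (a b c : ℤ) (x : ℂ) : ℂ :=
  (-x) ^ (-b) * tetraIndex (b - c) (a - b) x

open Filter Topology

lemma one_sub_sq_pow_ne_zero {x : ℂ} (hx : ‖x‖ < 1) (i : ℕ) : 1 - (x ^ 2) ^ (i + 1) ≠ 0 := by
  intro h
  have h1 : ‖(x ^ 2) ^ (i + 1)‖ < 1 := by
    rw [norm_pow, norm_pow]
    exact pow_lt_one₀ (by positivity) (pow_lt_one₀ (norm_nonneg _) hx two_ne_zero) (by simp)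
  rw [← sub_eq_zero.mp h] at h1
  simp at h1

lemma qPoch_ne_zero {x : ℂ} (hx : ‖x‖ < 1) (n : ℕ) : qPoch x n ≠ 0 :=
  Finset.prod_ne_zero_iff.mpr fun i _ => one_sub_sq_pow_ne_zero hx i

lemma qPoch_zero (x : ℂ) : qPoch x 0 = 1 := by simp [qPoch]

lemma qPoch_succ (x : ℂ) (n : ℕ) :
    qPoch x (n + 1) = qPoch x n * (1 - (x ^ 2) ^ (n + 1)) := by
  simp [qPoch, Finset.prod_range_succ]

lemma tendsto_qPoch (n : ℕ) : Tendsto (fun x => qPoch x n) (𝓝[≠] 0) (𝓝 1) := by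
  have h : Continuous fun x => qPoch x n := by unfold qPoch; fun_prop
  have h0 : qPoch 0 n = 1 := by simp [qPoch]
  simpa [h0] using (h.tendsto 0).mono_left nhdsWithin_le_nhds

lemma norm_inv_qPoch_le {x : ℂ} (hx : ‖x‖ ≤ 1 / 8) (n : ℕ) : ‖(qPoch x n)⁻¹‖ ≤ 2 ^ n := by
  induction n with
  | zero => simp [qPoch]
  | succ n ih =>
    rw [qPoch_succ, mul_inv, norm_mul, pow_succ]
    refine mul_le_mul ih ?_ (norm_nonneg _) (pow_nonneg zero_le_two n)
    have h1 : ‖(x ^ 2) ^ (n + 1)‖ ≤ 1 / 2 := by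
      rw [← pow_mul, norm_pow]
      calc ‖x‖ ^ (2 * (n + 1)) ≤ ‖x‖ ^ 1 :=
            pow_le_pow_of_le_one (norm_nonneg _) (by linarith) (by omega)
        _ ≤ 1 / 2 := by linarith [pow_one ‖x‖]
    have h2 : 1 / 2 ≤ ‖1 - (x ^ 2) ^ (n + 1)‖ := by
      have := norm_sub_norm_le (1 : ℂ) ((x ^ 2) ^ (n + 1))
      rw [norm_one] at this
      linarith
    rw [norm_inv]
    exact inv_le_of_inv_le₀ (by norm_num) (by rwa [← one_div])

/-- A power series with denominators tending to `1` has a limit governed by its leading term. -/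
lemma tendsto_tsum_leading {g : ℕ → ℕ} (hg0 : g 0 = 0) (hg : ∀ j, j ≤ g j)
    {D : ℕ → ℂ → ℂ} (hD : ∀ j, Tendsto (D j) (𝓝[≠] 0) (𝓝 1)) {C : ℝ}
    (hDC : ∀ j x, ‖x‖ ≤ 1 / 8 → ‖(D j x)⁻¹‖ ≤ C * 4 ^ j) :
    Tendsto (fun x : ℂ => ∑' j : ℕ, (-1) ^ j * x ^ g j / D j x) (𝓝[≠] 0) (𝓝 1) := by
  have hlim : ∑' j : ℕ, (if j = 0 then (1 : ℂ) else 0) = 1 := by simp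
  suffices H : Tendsto (fun x : ℂ => ∑' j : ℕ, (-1) ^ j * x ^ g j / D j x) (𝓝[≠] 0)
      (𝓝 (∑' j : ℕ, (if j = 0 then (1 : ℂ) else 0))) by rwa [hlim] at H
  refine tendsto_tsum_of_dominated_convergence (bound := fun j => C * (1 / 2) ^ j)
    ((summable_geometric_of_lt_one (by norm_num) (by norm_num)).mul_left C) (fun j => ?_) ?_
  · have hpow : Tendsto (fun x : ℂ => (-1) ^ j * x ^ g j) (𝓝[≠] 0) (𝓝 ((-1) ^ j * 0 ^ g j)) :=
      (Continuous.tendsto (by fun_prop) 0).mono_left nhdsWithin_le_nhds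
    have h := hpow.div (hD j) one_ne_zero
    have hval : (if j = 0 then (1 : ℂ) else 0) = (-1) ^ j * 0 ^ g j / 1 := by
      rcases Nat.eq_zero_or_pos j with rfl | hj
      · simp [hg0]
      · have := hg j
        simp [hj.ne', show g j ≠ 0 by omega]
    rw [hval]
    exact h
  · have hball : ∀ᶠ x : ℂ in 𝓝[≠] 0, ‖x‖ ≤ 1 / 8 := by
      refine nhdsWithin_le_nhds ?_
      filter_upwards [Metric.closedBall_mem_nhds (0 : ℂ) (show (0 : ℝ) < 1 / 8 by norm_num)]
        with x hx
      simpa using hx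
    filter_upwards [hball] with x hx j
    rw [div_eq_mul_inv, norm_mul, norm_mul, norm_pow, norm_neg, norm_one, one_pow, one_mul,
      norm_pow]
    calc ‖x‖ ^ g j * ‖(D j x)⁻¹‖ ≤ (1 / 8) ^ j * (C * 4 ^ j) := by
          refine mul_le_mul ?_ (hDC j x hx) (norm_nonneg _) (by positivity)
          calc ‖x‖ ^ g j ≤ ‖x‖ ^ j :=
                pow_le_pow_of_le_one (norm_nonneg _) (by linarith) (hg j)
            _ ≤ (1 / 8) ^ j := pow_le_pow_left₀ (norm_nonneg _) hx j
      _ = C * (1 / 2) ^ j := by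
          rw [mul_left_comm, ← mul_pow]; norm_num

/-- The `k`-th term of Euler's series for `(q^u; q)_∞`, where `q = x ^ 2`. -/
noncomputable def eulerTerm (x : ℂ) (u : ℤ) (k : ℕ) : ℂ :=
  (-1) ^ k * x ^ ((k : ℤ) * (k - 1) + 2 * u * k) / qPoch x k

/-- Euler's series for `(q^u; q)_∞`, where `q = x ^ 2`. -/
noncomputable def eulerSeries (x : ℂ) (u : ℤ) : ℂ :=
  ∑' k : ℕ, eulerTerm x u k

lemma eulerTerm_succ {x : ℂ} (hx0 : x ≠ 0) (u : ℤ) (k : ℕ) :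
    eulerTerm x u (k + 1) =
      eulerTerm x u k * (-(x ^ (2 * u) * (x ^ 2) ^ k) / (1 - (x ^ 2) ^ (k + 1))) := by
  have h : x ^ (((k + 1 : ℕ) : ℤ) * ((k + 1 : ℕ) - 1) + 2 * u * (k + 1 : ℕ)) =
      x ^ ((k : ℤ) * (k - 1) + 2 * u * k) * (x ^ (2 * u) * (x ^ 2) ^ k) := by
    rw [← pow_mul, ← zpow_natCast x (2 * k), ← zpow_add₀ hx0, ← zpow_add₀ hx0]
    congr 1
    push_cast
    ring
  rw [eulerTerm, h, eulerTerm, qPoch_succ, pow_succ, div_mul_div_comm]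
  ring

lemma summable_eulerTerm {x : ℂ} (hx0 : x ≠ 0) (hx : ‖x‖ < 1) (u : ℤ) :
    Summable fun k => ‖eulerTerm x u k‖ := by
  have hne : ∀ k, eulerTerm x u k ≠ 0 := fun k =>
    div_ne_zero (mul_ne_zero (pow_ne_zero _ (by norm_num)) (zpow_ne_zero _ hx0))
      (qPoch_ne_zero hx k)
  have hq : ‖x ^ 2‖ < 1 := by
    rw [norm_pow]
    exact pow_lt_one₀ (norm_nonneg _) hx two_ne_zero
  have hpow := tendsto_pow_atTop_nhds_zero_of_norm_lt_one hq
  have hden : Tendsto (fun k : ℕ => 1 - (x ^ 2) ^ (k + 1)) atTop (𝓝 (1 - 0)) :=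
    tendsto_const_nhds.sub (hpow.comp (tendsto_add_atTop_nat 1))
  have hratio := ((hpow.const_mul (x ^ (2 * u))).neg.div hden (by simp)).norm
  refine summable_of_ratio_test_tendsto_lt_one (l := 0) zero_lt_one
    (Eventually.of_forall fun k => norm_ne_zero_iff.mpr (hne k)) ?_
  simp only [norm_norm]
  simp only [mul_zero, neg_zero, zero_div, norm_zero] at hratio
  refine hratio.congr fun k => ?_
  rw [eulerTerm_succ hx0, norm_mul, mul_div_cancel_left₀ _ (norm_ne_zero_iff.mpr (hne k))]
  rfl

lemma eulerTerm_add_one {x : ℂ} (hx0 : x ≠ 0) (u : ℤ) (k : ℕ) :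
    eulerTerm x (u + 1) k = (x ^ 2) ^ k * eulerTerm x u k := by
  rw [eulerTerm, eulerTerm, show (k : ℤ) * (k - 1) + 2 * (u + 1) * k =
    ((2 * k : ℕ) : ℤ) + ((k : ℤ) * (k - 1) + 2 * u * k) by push_cast; ring, zpow_add₀ hx0,
    zpow_natCast, pow_mul]
  ring

lemma eulerSeries_eq {x : ℂ} (hx0 : x ≠ 0) (hx : ‖x‖ < 1) (u : ℤ) :
    eulerSeries x u = (1 - x ^ (2 * u)) * eulerSeries x (u + 1) := by
  have hs : ∀ v, Summable (eulerTerm x v) := fun v => (summable_eulerTerm hx0 hx v).of_norm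
  have hdiff : eulerSeries x u - eulerSeries x (u + 1) =
      -x ^ (2 * u) * eulerSeries x (u + 1) := by
    rw [eulerSeries, eulerSeries, ← (hs u).tsum_sub (hs (u + 1)),
      ((hs u).sub (hs (u + 1))).tsum_eq_zero_add, ← tsum_mul_left]
    have h0 : eulerTerm x u 0 - eulerTerm x (u + 1) 0 = 0 := by simp [eulerTerm]
    rw [h0, zero_add]
    refine tsum_congr fun k => ?_
    have hk := one_sub_sq_pow_ne_zero hx k
    rw [eulerTerm_add_one hx0, eulerTerm_add_one hx0, eulerTerm_succ hx0]
    field_simp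
    ring
  linear_combination hdiff

lemma eulerSeries_mul_qPoch {x : ℂ} (hx0 : x ≠ 0) (hx : ‖x‖ < 1) (n : ℕ) :
    eulerSeries x (n + 1) * qPoch x n = eulerSeries x 1 := by
  induction n with
  | zero => simp [qPoch]
  | succ n ih =>
    rw [← ih, eulerSeries_eq hx0 hx (n + 1), qPoch_succ,
      show (2 * ((n : ℤ) + 1)) = ((2 * (n + 1) : ℕ) : ℤ) by push_cast; ring, zpow_natCast, pow_mul]
    push_cast
    ring

lemma eulerSeries_neg {x : ℂ} (hx0 : x ≠ 0) (hx : ‖x‖ < 1) (n : ℕ) :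
    eulerSeries x (-n) = 0 := by
  induction n with
  | zero => rw [eulerSeries_eq hx0 hx]; simp
  | succ n ih =>
    rw [eulerSeries_eq hx0 hx, show -((n + 1 : ℕ) : ℤ) + 1 = -n by push_cast; ring, ih, mul_zero]

lemma eventually_eulerSeries_one_ne_zero : ∀ᶠ x : ℂ in 𝓝[≠] 0, eulerSeries x 1 ≠ 0 := by
  have h : Tendsto (fun x : ℂ => eulerSeries x 1) (𝓝[≠] 0) (𝓝 1) := by
    refine (tendsto_tsum_leading (g := fun j => j * (j + 1)) (by simp)
      (fun j => by nlinarith) (D := fun j x => qPoch x j) tendsto_qPoch (C := 1)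
      fun j x hx => ?_).congr fun x => tsum_congr fun j => ?_
    · rw [one_mul]
      exact (norm_inv_qPoch_le hx j).trans (pow_le_pow_left₀ (by norm_num) (by norm_num) j)
    · rw [eulerTerm, ← zpow_natCast x]
      congr 3
      push_cast
      ring
  exact h.eventually_ne one_ne_zero

lemma eulerTerm_mul_eulerTerm {x : ℂ} (hx0 : x ≠ 0) (u v : ℤ) (n k : ℕ) :
    eulerTerm x u n * eulerTerm x (n + v) k =
      x ^ (2 * (n * k)) * (eulerTerm x u n * eulerTerm x v k) := by
  have h : x ^ ((k : ℤ) * (k - 1) + 2 * (n + v) * k) =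
      x ^ (2 * (n * k)) * x ^ ((k : ℤ) * (k - 1) + 2 * v * k) := by
    rw [← zpow_natCast x, ← zpow_add₀ hx0]
    congr 1
    push_cast
    ring
  rw [eulerTerm, eulerTerm, eulerTerm, h]
  ring

lemma tsum_eulerTerm_mul_eulerSeries_comm {x : ℂ} (hx0 : x ≠ 0) (hx : ‖x‖ < 1) (u v : ℤ) :
    ∑' n : ℕ, eulerTerm x u n * eulerSeries x (n + v) =
      ∑' n : ℕ, eulerTerm x v n * eulerSeries x (n + u) := by
  have hsum : Summable (Function.uncurry fun n k : ℕ =>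
      x ^ (2 * (n * k)) * (eulerTerm x u n * eulerTerm x v k)) := by
    refine Summable.of_norm_bounded
      (g := fun p : ℕ × ℕ => ‖eulerTerm x u p.1‖ * ‖eulerTerm x v p.2‖)
      ((summable_eulerTerm hx0 hx u).mul_of_nonneg (summable_eulerTerm hx0 hx v)
        (fun _ => norm_nonneg _) (fun _ => norm_nonneg _)) fun p => ?_
    rw [Function.uncurry_def, norm_mul, norm_mul, norm_pow]
    exact mul_le_of_le_one_left (by positivity) (pow_le_one₀ (norm_nonneg _) hx.le)
  simp only [eulerSeries, ← tsum_mul_left, eulerTerm_mul_eulerTerm hx0]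
  refine hsum.tsum_comm.symm.trans ?_
  refine tsum_congr fun n => tsum_congr fun k => ?_
  rw [mul_comm k n, mul_comm (eulerTerm x u k)]

lemma tetraIndex_mul_eulerSeries {x : ℂ} (hx0 : x ≠ 0) (hx : ‖x‖ < 1) (m e : ℤ) :
    tetraIndex m e x * eulerSeries x 1 =
      x ^ (-(e * m)) * ∑' n : ℕ, eulerTerm x (1 - m) n * eulerSeries x (n + (e + 1)) := by
  obtain ⟨N, hN⟩ := Int.eq_ofNat_of_zero_le (le_max_right (-e) 0)
  have hNe : -e ≤ N := hN ▸ le_max_left _ _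
  have hshift : ∑' n : ℕ, eulerTerm x (1 - m) n * eulerSeries x (n + (e + 1)) =
      ∑' j : ℕ, eulerTerm x (1 - m) (N + j) * eulerSeries x ((N + j : ℕ) + (e + 1)) := by
    refine ((add_right_injective N).tsum_eq
      (f := fun n : ℕ => eulerTerm x (1 - m) n * eulerSeries x (n + (e + 1))) ?_).symm
    intro n hn
    refine ⟨n - N, Nat.add_sub_cancel' ?_⟩
    by_contra hlt
    refine hn ?_
    obtain ⟨k, hk⟩ := Int.eq_ofNat_of_zero_le (show 0 ≤ -((n : ℤ) + (e + 1)) by omega)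
    have : (n : ℤ) + (e + 1) = -k := by omega
    simp only [this, eulerSeries_neg hx0 hx, mul_zero]
  rw [hshift, tetraIndex, ← tsum_mul_right, ← tsum_mul_left]
  refine tsum_congr fun j => ?_
  obtain ⟨M, hM⟩ := Int.eq_ofNat_of_zero_le (show 0 ≤ ((N + j : ℕ) : ℤ) + e by push_cast; omega)
  have hexp : x ^ (((N + j : ℕ) : ℤ) * ((N + j : ℕ) + 1) - (2 * (N + j : ℕ) + e) * m) =
      x ^ (-(e * m)) * x ^ (((N + j : ℕ) : ℤ) * ((N + j : ℕ) - 1) + 2 * (1 - m) * (N + j : ℕ)) := by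
    rw [← zpow_add₀ hx0]
    congr 1
    ring
  have h1 := qPoch_ne_zero hx (N + j)
  have h2 := qPoch_ne_zero hx M
  rw [hN, show ((N : ℤ) + j) = ((N + j : ℕ) : ℤ) by push_cast; ring, tetraTerm, hM, hexp,
    Int.toNat_natCast, Int.toNat_natCast, zpow_natCast, ← add_assoc, hM,
    ← eulerSeries_mul_qPoch hx0 hx M, eulerTerm]
  field_simp

lemma eventually_norm_lt_one : ∀ᶠ x : ℂ in 𝓝[≠] 0, ‖x‖ < 1 := by
  refine nhdsWithin_le_nhds ?_
  filter_upwards [Metric.ball_mem_nhds (0 : ℂ) one_pos] with x hx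
  simpa using hx

lemma eventually_Jsym_swap (a b c : ℤ) : ∀ᶠ x : ℂ in 𝓝[≠] 0, Jsym a b c x = Jsym c b a x := by
  filter_upwards [eventually_eulerSeries_one_ne_zero, eventually_norm_lt_one,
    self_mem_nhdsWithin] with x hE hx hx0
  have hx0 : x ≠ 0 := hx0
  rw [Jsym, Jsym]
  congr 1
  refine mul_right_cancel₀ hE ?_
  rw [tetraIndex_mul_eulerSeries hx0 hx, tetraIndex_mul_eulerSeries hx0 hx,
    tsum_eulerTerm_mul_eulerSeries_comm hx0 hx]
  congr 2
  · ring
  · ext n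
    congr 2 <;> ring

lemma tendsto_Jsym_of_le {a b c : ℤ} (h : b ≤ c ∨ a ≤ c) {n d : ℤ} (hn : n = max (b - a) 0)
    (hd : d = n * (n + 1) - (2 * n + (a - b)) * (b - c) - b) :
    ∃ L : ℂ, L ≠ 0 ∧ Tendsto (fun x : ℂ => x ^ (-d) * Jsym a b c x) (𝓝[≠] 0) (𝓝 L) := by
  obtain ⟨N, hN⟩ := Int.eq_ofNat_of_zero_le (show 0 ≤ n by omega)
  obtain ⟨M, hM⟩ := Int.eq_ofNat_of_zero_le (show 0 ≤ n + (a - b) by omega)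
  obtain ⟨K, hK⟩ := Int.eq_ofNat_of_zero_le (show 0 ≤ n - (b - c) by omega)
  have hlead := tendsto_tsum_leading (g := fun j => j * (j + 1) + 2 * j * K) (by simp)
    (fun j => by nlinarith [Nat.zero_le (2 * j * K)])
    (D := fun j x => qPoch x (N + j) * qPoch x (M + j))
    (fun j => by simpa using (tendsto_qPoch (N + j)).mul (tendsto_qPoch (M + j)))
    (C := 2 ^ N * 2 ^ M) (fun j x hx => by
      rw [mul_inv, norm_mul]
      refine (mul_le_mul (norm_inv_qPoch_le hx _) (norm_inv_qPoch_le hx _) (norm_nonneg _)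
        (by positivity)).trans_eq ?_
      rw [show (4 : ℝ) = 2 * 2 by norm_num, mul_pow]
      ring)
  refine ⟨(-1) ^ (-b) * (-1) ^ N, mul_ne_zero (zpow_ne_zero _ (by norm_num))
    (pow_ne_zero _ (by norm_num)), ?_⟩
  rw [← mul_one ((-1 : ℂ) ^ (-b) * (-1) ^ N)]
  refine (hlead.const_mul _).congr' ?_
  filter_upwards [self_mem_nhdsWithin] with x hx0
  have hx0 : x ≠ 0 := hx0
  rw [Jsym, tetraIndex, ← tsum_mul_left, ← tsum_mul_left, ← tsum_mul_left]
  refine tsum_congr fun j => ?_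
  have hexp : x ^ (j * (j + 1) + 2 * j * K) = x ^ (-d) * (x ^ (-b) *
      x ^ (((N + j : ℕ) : ℤ) * ((N + j : ℕ) + 1) - (2 * (N + j : ℕ) + (a - b)) * (b - c))) := by
    rw [← zpow_natCast x, ← zpow_add₀ hx0, ← zpow_add₀ hx0, hd, hN]
    congr 1
    push_cast
    rw [← hK, hN]
    ring
  rw [show max (-(a - b)) 0 + (j : ℤ) = ((N + j : ℕ) : ℤ) by push_cast; omega, tetraTerm,
    show ((N + j : ℕ) : ℤ) + (a - b) = ((M + j : ℕ) : ℤ) by push_cast; omega,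
    Int.toNat_natCast, Int.toNat_natCast, zpow_natCast, hexp, neg_eq_neg_one_mul x, mul_zpow,
    pow_add]
  ring

/-- the order of vanishing of `J_Δ(a,b,c)` at `x = 0` equals
`δ(a-m,b-m,c-m) - m` where `m = min{a,b,c}` and `δ(α,β,γ) = αβ+βγ+γα`. -/
theorem Jsym_order_of_vanishing (a b c : ℤ) :
    ∃ L : ℂ, L ≠ 0 ∧
      Filter.Tendsto
        (fun x : ℂ =>
          x ^ (-((a - min a (min b c)) * (b - min a (min b c)) +
                 (b - min a (min b c)) * (c - min a (min b c)) +
                 (c - min a (min b c)) * (a - min a (min b c)) - min a (min b c))) *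
            Jsym a b c x)
        (nhdsWithin 0 {x : ℂ | x ≠ 0}) (nhds L) := by
  change ∃ L : ℂ, L ≠ 0 ∧ Tendsto _ (𝓝[≠] 0) (𝓝 L)
  by_cases h : b ≤ c ∨ a ≤ c
  · refine tendsto_Jsym_of_le h rfl ?_
    rcases le_total a b with hab | hab
    · rw [max_eq_left (by omega), min_eq_left (by omega)]
      ring
    · rw [max_eq_right (by omega), min_eq_right (by omega), min_eq_left (by omega)]
      ring
  · obtain ⟨L, hL, hlim⟩ := tendsto_Jsym_of_le (a := c) (b := b) (c := a) (by omega) rfl rfl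
    refine ⟨L, hL, hlim.congr' ?_⟩
    filter_upwards [eventually_Jsym_swap a b c] with x hx
    rw [hx, max_eq_left (by omega), min_eq_right (by omega : min b c ≤ a),
      min_eq_right (by omega : c ≤ b)]
    congr 2
    ring
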